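/- arXiv:2007.14192 — 2 statements merged into one kernel-verified Lean document; each statement's English description precedes it below -/
import Mathlib

section
/- Let T be a starshaped tree rooted at x in a weakly modular graph G (with equilateral metric triangles), and suppose distances between u',v' ∈ T along T equal d_T. Then for any two vertices u, v of T, d_G(u,v) ≤ d_T(u,v) ≤ 2·d_G(u,v), where d_T denotes the distance in the tree obtained as the union of the branches I(x,s), s ∈ T. -/
open SimpleGraph

variable {V : Type*}

/-- The metric interval between `u` and `v`. -/
def interval (G : SimpleGraph V) (u v : V) : Set V :=
  {w | G.dist u w + G.dist w v = G.dist u v}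

/-- Triangle condition (TC). -/
def TriangleCondition (G : SimpleGraph V) : Prop :=
  ∀ (k : ℕ) (u v w : V), G.dist u v = k + 1 → G.dist u w = k + 1 → G.Adj v w →
    ∃ x, G.dist u x = k ∧ G.Adj x v ∧ G.Adj x w

/-- Quadrangle condition (QC). -/
def QuadrangleCondition (G : SimpleGraph V) : Prop :=
  ∀ (k : ℕ) (u v w z : V), G.dist u v = k + 1 → G.dist u w = k + 1 →
    G.dist u z = k + 2 → G.Adj v z → G.Adj w z →
    ∃ x, G.dist u x = k ∧ G.Adj x v ∧ G.Adj x w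

def WeaklyModular (G : SimpleGraph V) : Prop :=
  TriangleCondition G ∧ QuadrangleCondition G

/-- No induced 4-cycle. -/
def NoInducedC4 (G : SimpleGraph V) : Prop :=
  ¬ ∃ a b c d : V, G.Adj a b ∧ G.Adj b c ∧ G.Adj c d ∧ G.Adj d a ∧
    a ≠ c ∧ b ≠ d ∧ ¬ G.Adj a c ∧ ¬ G.Adj b d

/-- No induced 5-cycle. -/
def NoInducedC5 (G : SimpleGraph V) : Prop :=
  ¬ ∃ a b c d e : V, G.Adj a b ∧ G.Adj b c ∧ G.Adj c d ∧ G.Adj d e ∧ G.Adj e a ∧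
    a ≠ c ∧ a ≠ d ∧ b ≠ d ∧ b ≠ e ∧ c ≠ e ∧
    ¬ G.Adj a c ∧ ¬ G.Adj a d ∧ ¬ G.Adj b d ∧ ¬ G.Adj b e ∧ ¬ G.Adj c e

/-- Bridged graph: weakly modular with no induced `C₄` or `C₅`. -/
def Bridged (G : SimpleGraph V) : Prop :=
  WeaklyModular G ∧ NoInducedC4 G ∧ NoInducedC5 G

/-- No clique on four vertices. -/
def K4Free (G : SimpleGraph V) : Prop :=
  ¬ ∃ a b c d : V, G.Adj a b ∧ G.Adj a c ∧ G.Adj a d ∧ G.Adj b c ∧ G.Adj b d ∧ G.Adj c d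

/-- Closed neighborhood `N[z]`. -/
def closedNbhd (G : SimpleGraph V) (z : V) : Set V := insert z (G.neighborSet z)

/-- Metric projection of `u` on a set `A`. -/
def mproj (G : SimpleGraph V) (u : V) (A : Set V) : Set V :=
  {a ∈ A | ∀ b ∈ A, G.dist u a ≤ G.dist u b}

/-- The star `St(z)`: `N[z]` together with all vertices outside `N[z]` having two
adjacent neighbors in `N[z]`. -/
def starSet (G : SimpleGraph V) (z : V) : Set V :=
  closedNbhd G z ∪
    {u | u ∉ closedNbhd G z ∧ ∃ y y', G.Adj y y' ∧ G.Adj z y ∧ G.Adj z y' ∧ G.Adj u y ∧ G.Adj u y'}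

/-- The panel of a neighbor `x` of `z`: vertices with unique projection `x` on `N[z]`. -/
def panelFiber (G : SimpleGraph V) (z x : V) : Set V :=
  {u | mproj G u (closedNbhd G z) = {x}}

/-- The cone of a vertex `x` at distance 2 from `z` in `St(z)`. -/
def coneFiber (G : SimpleGraph V) (z x : V) : Set V :=
  {u | ∃ y y', y ≠ y' ∧ G.Adj y y' ∧ G.Adj z y ∧ G.Adj z y' ∧ G.Adj x y ∧ G.Adj x y' ∧
    mproj G u (closedNbhd G z) = {y, y'} ∧ G.dist u x + 1 = G.dist u y}

/-- The fiber of `x ∈ St(z)`: a panel if `x ~ z`, a cone otherwise. -/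
def fiberSet (G : SimpleGraph V) (z x : V) : Set V :=
  {u | (G.Adj x z ∧ u ∈ panelFiber G z x) ∨ (¬ G.Adj x z ∧ u ∈ coneFiber G z x)}

/-- Total boundary of a fiber `F`: the vertices of `F` with a neighbor outside `F`
(i.e. in another fiber of the partition). -/
def totalBoundary (G : SimpleGraph V) (F : Set V) : Set V :=
  {u ∈ F | ∃ v, G.Adj u v ∧ v ∉ F}

/-- `S` is starshaped with respect to `x`. -/
def StarshapedWrt (G : SimpleGraph V) (x : V) (S : Set V) : Prop :=
  ∀ s ∈ S, interval G x s ⊆ S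

/-- `S` is a starshaped tree rooted at `x`: intervals to the root are contained in `S`
and each non-root vertex has a unique neighbor towards the root. -/
def StarshapedTree (G : SimpleGraph V) (x : V) (S : Set V) : Prop :=
  x ∈ S ∧ (∀ s ∈ S, interval G x s ⊆ S) ∧
    (∀ s ∈ S, s ≠ x → ∃! w, w ∈ interval G s x ∧ G.Adj s w)

/-- The tree obtained as the union of the branches of a starshaped tree `S` rooted
at `x`: its edges are the edges of `G` lying consecutively on some branch. -/
def branchTree (G : SimpleGraph V) (x : V) (S : Set V) : SimpleGraph V :=
  SimpleGraph.fromRel (fun u v => G.Adj u v ∧ u ∈ S ∧ v ∈ S ∧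
    ∃ s ∈ S, u ∈ interval G x s ∧ v ∈ interval G x s ∧ G.dist x v = G.dist x u + 1)

/-- Metric triangle. -/
def MetricTriangle (G : SimpleGraph V) (u1 u2 u3 : V) : Prop :=
  interval G u1 u2 ∩ interval G u2 u3 = {u2} ∧
  interval G u2 u3 ∩ interval G u3 u1 = {u3} ∧
  interval G u3 u1 ∩ interval G u1 u2 = {u1}

/-- Adjacent vertices differ by at most one in their distance to any vertex. -/
lemma dist_le_dist_add_one_of_adj {G : SimpleGraph V} (hc : G.Connected)
    (u : V) {v w : V} (h : G.Adj v w) :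
    G.dist u w ≤ G.dist u v + 1 ∧ G.dist u v ≤ G.dist u w + 1 := by
  have h1 : G.dist v w = 1 := dist_eq_one_iff_adj.mpr h
  have h2 : G.dist w v = 1 := dist_eq_one_iff_adj.mpr h.symm
  have h3 := hc.dist_triangle (u := u) (v := v) (w := w)
  have h4 := hc.dist_triangle (u := u) (v := w) (w := v)
  omega

/-- In a connected graph, every vertex other than `u` has a neighbor closer to `u`. -/
lemma exists_adj_dist_add_one {G : SimpleGraph V} (hc : G.Connected) {u v : V}
    (h : v ≠ u) : ∃ w, G.Adj v w ∧ G.dist u w + 1 = G.dist u v := by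
  obtain ⟨p, hp⟩ := hc.exists_walk_length_eq_dist v u
  cases p with
  | nil => exact absurd rfl h
  | @cons _ w _ hw q =>
    refine ⟨w, hw, ?_⟩
    have h1 := SimpleGraph.dist_le q
    have h2 := dist_le_dist_add_one_of_adj hc u hw
    rw [Walk.length_cons] at hp
    rw [SimpleGraph.dist_comm (u := w)] at h1
    rw [SimpleGraph.dist_comm (u := v)] at hp
    omega

/-- If the unique parent `b` of `a` is farther from `v` than `a`, then any parent `c` of `b` is
farther from `v` than `b`. -/
lemma dist_grandparent_eq {G : SimpleGraph V} (hc : G.Connected)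
    (hwm : WeaklyModular G) {x v a b c : V}
    (huniq : ∀ t, G.Adj a t → G.dist x t + 1 = G.dist x a → t = b)
    (hab : G.Adj a b) (hbc : G.Adj b c) (hxb : G.dist x b + 1 = G.dist x a)
    (hxc : G.dist x c + 1 = G.dist x b) (hv : G.dist v b = G.dist v a + 1) :
    G.dist v c = G.dist v b + 1 := by
  have hmid : ∀ t, G.Adj t a → G.Adj t c → t = b := by
    intro t ht1 ht2
    have h1 := dist_le_dist_add_one_of_adj hc x ht1
    have h2 := dist_le_dist_add_one_of_adj hc x ht2
    exact huniq t ht1.symm (by omega)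
  have hca : G.dist c a = 2 := by
    have h1 := dist_le_dist_add_one_of_adj hc c hab.symm
    have h2 : G.dist c b = 1 := dist_eq_one_iff_adj.mpr hbc.symm
    have h3 := hc.dist_triangle (u := x) (v := c) (w := a)
    omega
  have hvbc := dist_le_dist_add_one_of_adj hc v hbc
  by_contra hne
  obtain heq | heq : G.dist v c = G.dist v a ∨ G.dist v c = G.dist v b := by omega
  · obtain ⟨k, hk⟩ : ∃ k, G.dist v a = k + 1 := by
      refine Nat.exists_eq_succ_of_ne_zero fun h0 => ?_
      have h1 := hc.dist_eq_zero_iff.mp h0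
      have h2 := hc.dist_eq_zero_iff.mp (heq.trans h0)
      rw [← h1, ← h2, SimpleGraph.dist_self] at hca
      omega
    obtain ⟨t, ht, hta, htc⟩ := hwm.2 k v a c b hk (by omega) (by omega) hab hbc.symm
    rw [hmid t hta htc] at ht
    omega
  · obtain ⟨k, hk⟩ : ∃ k, G.dist v a = k + 1 := by
      refine Nat.exists_eq_succ_of_ne_zero fun h0 => ?_
      have h1 := hc.dist_eq_zero_iff.mp h0
      rw [h1, SimpleGraph.dist_comm] at heq
      have h2 : G.dist a b = 1 := dist_eq_one_iff_adj.mpr hab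
      omega
    obtain ⟨z, hz, hzb, hzc⟩ := hwm.1 (G.dist v a) v b c hv (by omega) hbc
    obtain ⟨y, hy, hya, hyz⟩ := hwm.2 k v a z b hk (by omega) (by omega) hab hzb
    have hcy : G.dist c y = 2 := by
      have h1 := dist_le_dist_add_one_of_adj hc c hyz
      have h2 : G.dist c z = 1 := dist_eq_one_iff_adj.mpr hzc.symm
      have h3 := hc.dist_triangle (u := v) (v := y) (w := c)
      rw [SimpleGraph.dist_comm (u := y)] at h3
      omega
    obtain ⟨t, ht, hta, hty⟩ := hwm.1 1 c a y hca hcy hya.symm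
    have htb := hmid t hta (dist_eq_one_iff_adj.mp ht).symm
    have h1 := dist_le_dist_add_one_of_adj hc v hty
    rw [htb] at h1
    omega

/-- A vertex other than `u` of the interval between `x` and `u` has a successor towards `u`. -/
lemma exists_next_mem_interval {G : SimpleGraph V} (hc : G.Connected) {x u y : V}
    (hy : y ∈ interval G x u) (hne : y ≠ u) :
    ∃ q ∈ interval G x u, G.Adj y q ∧ G.dist x q = G.dist x y + 1 ∧
      G.dist y u = G.dist q u + 1 := by
  obtain ⟨q, hq, hqd⟩ := exists_adj_dist_add_one hc hne
  have h1 := dist_le_dist_add_one_of_adj hc x hq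
  have h2 := hc.dist_triangle (u := x) (v := q) (w := u)
  simp only [interval, Set.mem_ofPred_eq] at hy ⊢
  rw [SimpleGraph.dist_comm, SimpleGraph.dist_comm (v := y)] at hqd
  exact ⟨q, by omega, hq, by omega, by omega⟩

lemma StarshapedTree.eq_of_adj {G : SimpleGraph V} {x : V} {S : Set V}
    (hS : StarshapedTree G x S) {s t t' : V} (hs : s ∈ S)
    (ht : G.Adj s t) (hxt : G.dist x t + 1 = G.dist x s)
    (ht' : G.Adj s t') (hxt' : G.dist x t' + 1 = G.dist x s) : t = t' := by
  have hne : s ≠ x := by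
    rintro rfl
    rw [SimpleGraph.dist_self] at hxt
    omega
  have hmem : ∀ {w}, G.Adj s w → G.dist x w + 1 = G.dist x s → w ∈ interval G s x := by
    intro w hw hd
    have h1 : G.dist s w = 1 := dist_eq_one_iff_adj.mpr hw
    simp only [interval, Set.mem_ofPred_eq]
    rw [SimpleGraph.dist_comm (u := w), SimpleGraph.dist_comm (v := x)]
    omega
  exact (hS.2.2 s hs hne).unique ⟨hmem ht hxt, ht⟩ ⟨hmem ht' hxt', ht'⟩

/-- If a vertex `y` of the branch of `u` is farther from `v` than `u`, then its successor on this
branch is closer to `v`. -/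
lemma StarshapedTree.exists_next_dist {G : SimpleGraph V} (hc : G.Connected)
    (hwm : WeaklyModular G) {x : V} {S : Set V} (hS : StarshapedTree G x S) {u : V} (hu : u ∈ S)
    (v : V) (n : ℕ) : ∀ y ∈ interval G x u, G.dist y u = n → G.dist v u < G.dist v y →
      ∃ p ∈ interval G x u, G.Adj y p ∧ G.dist x p = G.dist x y + 1 ∧
        G.dist v y = G.dist v p + 1 := by
  induction n with
  | zero =>
    intro y _ h0 hlt
    rw [hc.dist_eq_zero_iff.mp h0] at hlt
    exact absurd hlt (lt_irrefl _)
  | succ n ih =>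
    intro y hy hn hlt
    have hne : y ≠ u := by
      rintro rfl
      exact lt_irrefl _ hlt
    obtain ⟨q, hq, hyq, hxq, hqu⟩ := exists_next_mem_interval hc hy hne
    have hvq := dist_le_dist_add_one_of_adj hc v hyq
    by_cases hlt' : G.dist v q < G.dist v y
    · exact ⟨q, hq, hyq, hxq, by omega⟩
    · obtain ⟨p, hp, hqp, hxp, hvp⟩ := ih q hq (by omega) (by omega)
      have := dist_grandparent_eq hc hwm (x := x) (v := v)
        (fun t ht hxt => hS.eq_of_adj (hS.2.1 u hu hp) ht hxt hqp.symm hxp.symm)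
        hqp.symm hyq.symm hxp.symm hxq.symm hvp
      omega

/-- Any two vertices of a starshaped tree have a common ancestor which is at most as far from
each of them as they are from each other. -/
lemma StarshapedTree.exists_common_ancestor {G : SimpleGraph V} (hc : G.Connected)
    (hwm : WeaklyModular G) {x : V} {S : Set V} (hS : StarshapedTree G x S) {u v : V}
    (hu : u ∈ S) (hv : v ∈ S) :
    ∃ y ∈ interval G x u ∩ interval G x v,
      G.dist v y ≤ G.dist v u ∧ G.dist u y ≤ G.dist u v := by
  obtain ⟨y, hy, hmax⟩ :
      ∃ y ∈ interval G x u ∩ interval G x v,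
        ∀ p ∈ interval G x u ∩ interval G x v, G.dist x p ≤ G.dist x y := by
    have hfin : (G.dist x '' (interval G x u ∩ interval G x v)).Finite := by
      refine (Set.finite_Iic (G.dist x u)).subset ?_
      rintro _ ⟨p, hp, rfl⟩
      exact le_of_add_le_left (le_of_eq hp.1)
    have hne : (G.dist x '' (interval G x u ∩ interval G x v)).Nonempty :=
      ⟨_, x, by simp [interval], rfl⟩
    obtain ⟨_, ⟨y, hy, rfl⟩, hmax⟩ := Set.exists_max_image _ id hfin hne
    exact ⟨y, hy, fun p hp => hmax _ ⟨p, hp, rfl⟩⟩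
  have key : ∀ {a b : V}, a ∈ S → y ∈ interval G x a → y ∈ interval G x b →
      (∀ p ∈ interval G x a, p ∈ interval G x b → G.dist x p ≤ G.dist x y) →
      G.dist b y ≤ G.dist b a := by
    intro a b ha hya hyb hle
    by_contra! hlt
    obtain ⟨p, hp, -, hxp, hbp⟩ := hS.exists_next_dist hc hwm ha b _ y hya rfl hlt
    have hpb : p ∈ interval G x b := by
      simp only [interval, Set.mem_ofPred_eq] at hyb ⊢
      rw [SimpleGraph.dist_comm (u := b), SimpleGraph.dist_comm (u := b)] at hbp
      omega
    have := hle p hp hpb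
    omega
  exact ⟨y, hy, key hu hy.1 hy.2 fun p h1 h2 => hmax p ⟨h1, h2⟩,
    key hv hy.2 hy.1 fun p h1 h2 => hmax p ⟨h2, h1⟩⟩

/-- Branches are paths of the branch tree. -/
lemma StarshapedTree.exists_branch_walk {G : SimpleGraph V} (hc : G.Connected)
    {x : V} {S : Set V} (hS : StarshapedTree G x S) {u : V} (hu : u ∈ S) (n : ℕ) :
    ∀ y ∈ interval G x u, G.dist y u = n → ∃ p : (branchTree G x S).Walk y u, p.length = n := by
  induction n with
  | zero =>
    intro y _ h0
    obtain rfl := hc.dist_eq_zero_iff.mp h0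
    exact ⟨.nil, rfl⟩
  | succ n ih =>
    intro y hy hn
    have hne : y ≠ u := by
      rintro rfl
      rw [SimpleGraph.dist_self] at hn
      omega
    obtain ⟨q, hq, hyq, hxq, hqu⟩ := exists_next_mem_interval hc hy hne
    obtain ⟨p, hp⟩ := ih q hq (by omega)
    have hadj : (branchTree G x S).Adj y q :=
      ⟨hyq.ne, Or.inl ⟨hyq, hS.2.1 u hu hy, hS.2.1 u hu hq, u, hu, hy, hq, hxq⟩⟩
    exact ⟨.cons hadj p, by rw [Walk.length_cons, hp]⟩

lemma branchTree_le (G : SimpleGraph V) (x : V) (S : Set V) :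
    branchTree G x S ≤ G := by
  rintro a b ⟨-, h | h⟩
  · exact h.1
  · exact h.1.symm

/-- Distances in the tree of branches of a starshaped tree approximate graph
distances within a factor 2. -/
theorem stmt12 (G : SimpleGraph V) (hc : G.Connected) (hwm : WeaklyModular G)
    (x : V) (S : Set V) (hS : StarshapedTree G x S) :
    ∀ u ∈ S, ∀ v ∈ S,
      G.dist u v ≤ (branchTree G x S).dist u v ∧
      (branchTree G x S).dist u v ≤ 2 * G.dist u v := by
  intro u hu v hv
  obtain ⟨y, ⟨hyu, hyv⟩, h1, h2⟩ := hS.exists_common_ancestor hc hwm hu hv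
  obtain ⟨p, hp⟩ := hS.exists_branch_walk hc hu _ y hyu rfl
  obtain ⟨q, hq⟩ := hS.exists_branch_walk hc hv _ y hyv rfl
  constructor
  · exact (p.reverse.append q).reachable.dist_anti (branchTree_le G x S)
  · have h3 := SimpleGraph.dist_le (p.reverse.append q)
    rw [Walk.length_append, Walk.length_reverse, hp, hq] at h3
    rw [SimpleGraph.dist_comm (u := v) (v := u), SimpleGraph.dist_comm (u := v)] at h1
    rw [SimpleGraph.dist_comm (u := u) (v := y)] at h2
    omega
end

section
/- Let T be a starshaped tree rooted at z in a K4-free bridged graph G, and let u ∉ T. Let u1 and u2 be the two extremal vertices (with respect to z) of the at most two increasing paths of I(u,z) ∩ T. Then for every vertex v ∈ T: min{ d_G(u,u1) + d_T(u1,v), d_G(u,u2) + d_T(u2,v) } ≤ 2·d_G(u,v). -/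
open SimpleGraph

variable {V : Type*}

/-- Along an edge, the distance to a fixed vertex grows by at most one. -/
theorem dist_le_succ_of_adj {G : SimpleGraph V} (hc : G.Connected) (x : V) {a b : V}
    (h : G.Adj a b) : G.dist x b ≤ G.dist x a + 1 := by
  have h1 := hc.dist_triangle (u := x) (v := a) (w := b)
  rw [dist_eq_one_iff_adj.2 h] at h1
  exact h1

/-- A vertex at positive distance from `b` has a neighbor one step closer to `b`. -/
theorem exists_adj_dist_eq {G : SimpleGraph V} (hc : G.Connected) {a b : V} {n : ℕ}
    (h : G.dist a b = n + 1) : ∃ c, G.Adj a c ∧ G.dist c b = n := by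
  obtain ⟨p, hp⟩ := hc.exists_walk_length_eq_dist a b
  cases p with
  | nil => simp at h
  | @cons _ c _ hac q =>
    refine ⟨c, hac, ?_⟩
    have h1 := dist_le q
    have h2 := dist_le_succ_of_adj hc b hac.symm
    rw [G.dist_comm (u := b), G.dist_comm (u := b)] at h2
    rw [Walk.length_cons] at hp
    omega

/-- If `w` is farther from `u` than `v` is, then some neighbor of `w` is closer to both
`u` and `v`. -/
theorem exists_adj_closer_both {G : SimpleGraph V} (hc : G.Connected) (hb : Bridged G)
    (u v : V) (m : ℕ) (w : V) (hm : G.dist v w = m) (h : G.dist u v < G.dist u w) :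
    ∃ x, G.Adj w x ∧ G.dist u x + 1 = G.dist u w ∧ G.dist v x + 1 = G.dist v w := by
  obtain ⟨⟨hTC, hQC⟩, hC4, -⟩ := hb
  induction m generalizing w with
  | zero =>
    rw [hc.dist_eq_zero_iff] at hm
    subst hm
    omega
  | succ m ih =>
    obtain ⟨p, hwp, hp⟩ := exists_adj_dist_eq hc (a := w) (b := v) (n := m)
      (by rw [G.dist_comm, hm])
    rw [G.dist_comm] at hp
    obtain ⟨n, hn⟩ : ∃ n, G.dist u w = n + 1 := ⟨G.dist u w - 1, by omega⟩
    have h1 := dist_le_succ_of_adj hc u hwp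
    have h2 := dist_le_succ_of_adj hc u hwp.symm
    obtain h3 | h3 | h3 : G.dist u p = n ∨ G.dist u p = n + 1 ∨ G.dist u p = n + 2 := by omega
    · exact ⟨p, hwp, by omega, by omega⟩
    · obtain ⟨q, hpq, hq1, hq2⟩ := ih p hp (by omega)
      obtain ⟨x, hx, hxw, hxp⟩ := hTC n u w p hn h3 hwp
      have hxv := dist_le_succ_of_adj hc v hxw
      by_cases hxq : G.Adj x q
      · have := dist_le_succ_of_adj hc v hxq.symm
        exact ⟨x, hxw.symm, by omega, by omega⟩
      · exfalso
        have hxneq : x ≠ q := by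
          rintro rfl
          omega
        obtain _ | k := n
        · rw [hc.dist_eq_zero_iff] at hx
          have hq : u = q := hc.dist_eq_zero_iff.1 (by omega)
          exact hxneq (hx.symm.trans hq)
        · obtain ⟨y, hy, hyx, hyq⟩ := hQC k u x q p hx (by omega) h3 hxp hpq.symm
          refine hC4 ⟨x, p, q, y, hxp, hpq, hyq.symm, hyx, hxneq, ?_, hxq, ?_⟩
          · rintro rfl
            omega
          · intro hpy
            have := dist_le_succ_of_adj hc u hpy.symm
            omega
    · obtain ⟨q, hpq, hq1, hq2⟩ := ih p hp (by omega)
      obtain ⟨x, hx, hxw, hxq⟩ := hQC n u w q p hn (by omega) h3 hwp hpq.symm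
      have h4 := dist_le_succ_of_adj hc v hxw
      have h5 := dist_le_succ_of_adj hc v hxq.symm
      exact ⟨x, hxw.symm, by omega, by omega⟩

/-- Two distinct neighbors of `p`, both closer to `u`, are adjacent. -/
theorem adj_of_adj_closer {G : SimpleGraph V} (hc : G.Connected) (hb : Bridged G)
    {u p c c' : V} (hp : G.Adj p c) (hp' : G.Adj p c') (h : G.dist u c + 1 = G.dist u p)
    (h' : G.dist u c' + 1 = G.dist u p) (hne : c ≠ c') : G.Adj c c' := by
  obtain ⟨⟨-, hQC⟩, hC4, -⟩ := hb
  rcases hk : G.dist u c with _ | k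
  · have hk' : u = c' := hc.dist_eq_zero_iff.1 (by omega)
    exact absurd ((hc.dist_eq_zero_iff.1 hk).symm.trans hk') hne
  · obtain ⟨x, hx, hxc, hxc'⟩ := hQC k u c c' p hk (by omega) (by omega) hp.symm hp'.symm
    by_contra hcc
    refine hC4 ⟨p, c, x, c', hp, hxc.symm, hxc', hp'.symm, ?_, hne, ?_, hcc⟩
    · rintro rfl
      omega
    · intro hpx
      have := dist_le_succ_of_adj hc u hpx.symm
      omega

/-- A vertex has at most two neighbors closer to `u`. -/
theorem not_three_adj_closer {G : SimpleGraph V} (hc : G.Connected) (hb : Bridged G)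
    (hk4 : K4Free G) {u p a b c : V} (ha : G.Adj p a) (hb' : G.Adj p b) (hc' : G.Adj p c)
    (ha' : G.dist u a + 1 = G.dist u p) (hb'' : G.dist u b + 1 = G.dist u p)
    (hc'' : G.dist u c + 1 = G.dist u p) (hab : a ≠ b) (hac : a ≠ c) (hbc : b ≠ c) : False :=
  hk4 ⟨p, a, b, c, ha, hb', hc', adj_of_adj_closer hc hb ha hb' ha' hb'' hab,
    adj_of_adj_closer hc hb ha hc' ha' hc'' hac, adj_of_adj_closer hc hb hb' hc' hb'' hc'' hbc⟩

theorem mem_interval_symm {G : SimpleGraph V} {a b w : V} (h : w ∈ interval G a b) :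
    w ∈ interval G b a := by
  simp only [interval, Set.mem_ofPred_eq] at *
  rw [G.dist_comm (u := b) (v := w), G.dist_comm (u := w) (v := a), G.dist_comm (u := b) (v := a)]
  omega

theorem right_mem_interval (G : SimpleGraph V) (a b : V) : b ∈ interval G a b := by
  simp [interval]

theorem interval_trans {G : SimpleGraph V} (hc : G.Connected) {z a b c : V}
    (h1 : a ∈ interval G z b) (h2 : b ∈ interval G z c) : a ∈ interval G z c := by
  simp only [interval, Set.mem_ofPred_eq] at *
  have h3 := hc.dist_triangle (u := a) (v := b) (w := c)
  have h4 := hc.dist_triangle (u := z) (v := a) (w := c)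
  omega

/-- A vertex `p` of `I(z,w)` other than `w` has a neighbor in `I(p,w)`. -/
theorem exists_succ_mem_interval {G : SimpleGraph V} (hc : G.Connected) {z p w : V}
    (h : p ∈ interval G z w) (hne : p ≠ w) :
    ∃ c, G.Adj p c ∧ G.dist z c = G.dist z p + 1 ∧ c ∈ interval G z w ∧
      G.dist p w = G.dist c w + 1 := by
  obtain ⟨n, hn⟩ : ∃ n, G.dist p w = n + 1 :=
    ⟨G.dist p w - 1, by have := hc.pos_dist_of_ne hne; omega⟩
  obtain ⟨c, hpc, hcw⟩ := exists_adj_dist_eq hc hn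
  have h1 := dist_le_succ_of_adj hc z hpc
  have h2 := hc.dist_triangle (u := z) (v := c) (w := w)
  simp only [interval, Set.mem_ofPred_eq] at *
  exact ⟨c, hpc, by omega, by omega, by omega⟩

theorem StarshapedTree.parent_unique {G : SimpleGraph V} {z : V} {S : Set V}
    (hS : StarshapedTree G z S) {s a b : V} (hs : s ∈ S) (ha : G.Adj a s) (hb : G.Adj b s)
    (ha' : G.dist z s = G.dist z a + 1) (hb' : G.dist z s = G.dist z b + 1) : a = b := by
  have hne : s ≠ z := by
    rintro rfl
    simp at ha'
  have key : ∀ x, G.Adj x s → G.dist z s = G.dist z x + 1 → x ∈ interval G s z ∧ G.Adj s x := by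
    intro x hx hx'
    refine ⟨?_, hx.symm⟩
    simp only [interval, Set.mem_ofPred_eq]
    rw [dist_eq_one_iff_adj.2 hx.symm, G.dist_comm (u := x), G.dist_comm (u := s)]
    omega
  exact (hS.2.2 s hs hne).unique (key a ha ha') (key b hb hb')

/-- Geodesics towards the root of a starshaped tree are walks of its branch tree. -/
theorem StarshapedTree.exists_walk {G : SimpleGraph V} (hc : G.Connected) {z : V} {S : Set V}
    (hS : StarshapedTree G z S) {v : V} (hv : v ∈ S) (n : ℕ) (w : V) (hw : w ∈ interval G z v)
    (hn : G.dist w v = n) : ∃ p : (branchTree G z S).Walk w v, p.length = n := by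
  induction n generalizing w with
  | zero =>
    rw [hc.dist_eq_zero_iff] at hn
    subst hn
    exact ⟨.nil, rfl⟩
  | succ n ih =>
    have hne : w ≠ v := by
      rintro rfl
      simp at hn
    obtain ⟨c, hwc, hzc, hcv, hd⟩ := exists_succ_mem_interval hc hw hne
    obtain ⟨p, hp⟩ := ih c hcv (by omega)
    have hadj : (branchTree G z S).Adj w c :=
      (fromRel_adj _ _ _).2 ⟨hwc.ne, .inl ⟨hwc, hS.2.1 v hv hw,
        hS.2.1 v hv hcv, v, hv, hw, hcv, hzc⟩⟩
    exact ⟨.cons hadj p, by simp [hp]⟩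

theorem dist_succ_of_mem_interval {G : SimpleGraph V} {z u p c : V} (hp : p ∈ interval G z u)
    (hcu : c ∈ interval G z u) (h : G.dist z c = G.dist z p + 1) : G.dist u c + 1 = G.dist u p := by
  simp only [interval, Set.mem_ofPred_eq] at *
  rw [G.dist_comm (u := u), G.dist_comm (u := u)]
  omega

/-- Let `p` lie on `I(z,u) ∩ S` and have a neighbor `x` in `I(z,u)` on the same level. Then the
part of `I(z,u) ∩ S` above `p` is contained in a single branch. -/
theorem exists_exit_of_sibling {G : SimpleGraph V} (hc : G.Connected) (hb : Bridged G)
    (hk4 : K4Free G) {z : V} {S : Set V} (hS : StarshapedTree G z S) {u : V} (hu : u ∉ S)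
    (n : ℕ) (p x : V) (hn : G.dist u p = n) (hpS : p ∈ S)
    (hpu : p ∈ interval G z u) (hpx : G.Adj p x) (hxz : G.dist z x = G.dist z p)
    (hxu : G.dist u x = G.dist u p) :
    ∃ e ∈ S, e ∈ interval G z u ∧ p ∈ interval G z e ∧
      ∀ w ∈ S, w ∈ interval G z u → p ∈ interval G z w → w ∈ interval G z e := by
  induction n generalizing p x with
  | zero =>
    rw [hc.dist_eq_zero_iff] at hn
    exact absurd (hn ▸ hpS) hu
  | succ n ih =>
    obtain ⟨y, hy, hyp, hyx⟩ := hb.1.1 n u p x hn (by omega) hpx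
    have hzy : G.dist z y = G.dist z p + 1 := by
      have h1 := dist_le_succ_of_adj hc z hyp.symm
      have h2 := hc.dist_triangle (u := z) (v := y) (w := u)
      have h3 : G.dist z p + G.dist p u = G.dist z u := hpu
      rw [G.dist_comm (u := y)] at h2
      rw [G.dist_comm (u := p)] at h3
      omega
    have hyS : y ∉ S := fun h =>
      hpx.ne (hS.parent_unique h hyp.symm hyx.symm hzy (by omega))
    by_cases hch : ∃ c, G.Adj p c ∧ G.dist z c = G.dist z p + 1 ∧ c ∈ interval G z u ∧ c ∈ S
    · obtain ⟨c, hpc, hzc, hcu, hcS⟩ := hch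
      have hcd := dist_succ_of_mem_interval hpu hcu hzc
      have hyc : c ≠ y := fun h => hyS (h ▸ hcS)
      have hadj := adj_of_adj_closer hc hb hpc hyp.symm hcd (by omega) hyc
      obtain ⟨e, heS, heu, hce, he⟩ := ih c y (by omega) hcS hcu hadj (by omega) (by omega)
      have hpc' : p ∈ interval G z c := by
        simp only [interval, Set.mem_ofPred_eq, dist_eq_one_iff_adj.2 hpc]
        omega
      have hpe := interval_trans hc hpc' hce
      refine ⟨e, heS, heu, hpe, fun w hwS hwu hpw => ?_⟩
      by_cases hpw' : p = w
      · exact hpw' ▸ hpe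
      obtain ⟨d, hpd, hzd, hdw, -⟩ := exists_succ_mem_interval hc hpw hpw'
      have hdS := hS.2.1 w hwS hdw
      have hdu := interval_trans hc hdw hwu
      have hdc : d = c := by
        by_contra hdc
        exact not_three_adj_closer hc hb hk4 hpd hpc hyp.symm
          (dist_succ_of_mem_interval hpu hdu hzd) hcd (by omega) hdc
          (fun h => hyS (h ▸ hdS)) hyc
      subst hdc
      exact he w hwS hwu hdw
    · refine ⟨p, hpS, hpu, right_mem_interval G z p, fun w hwS hwu hpw => ?_⟩
      by_cases hpw' : p = w
      · exact hpw' ▸ right_mem_interval G z p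
      obtain ⟨d, hpd, hzd, hdw, -⟩ := exists_succ_mem_interval hc hpw hpw'
      exact absurd ⟨d, hpd, hzd, interval_trans hc hdw hwu, hS.2.1 w hwS hdw⟩ hch

/-- The part of `I(z,u) ∩ S` above any of its vertices is covered by two branches. -/
theorem exists_two_exits {G : SimpleGraph V} (hc : G.Connected) (hb : Bridged G)
    (hk4 : K4Free G) {z : V} {S : Set V} (hS : StarshapedTree G z S) {u : V} (hu : u ∉ S)
    (n : ℕ) (p : V) (hn : G.dist u p = n) (hpS : p ∈ S)
    (hpu : p ∈ interval G z u) :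
    ∃ e ∈ S, e ∈ interval G z u ∧ p ∈ interval G z e ∧ ∃ f ∈ S, f ∈ interval G z u ∧
      ∀ w ∈ S, w ∈ interval G z u → p ∈ interval G z w →
        w ∈ interval G z e ∨ w ∈ interval G z f := by
  induction n generalizing p with
  | zero =>
    rw [hc.dist_eq_zero_iff] at hn
    exact absurd (hn ▸ hpS) hu
  | succ n ih =>
    by_cases hch : ∃ c, G.Adj p c ∧ G.dist z c = G.dist z p + 1 ∧ c ∈ interval G z u ∧ c ∈ S
    · obtain ⟨c, hpc, hzc, hcu, hcS⟩ := hch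
      have hcd := dist_succ_of_mem_interval hpu hcu hzc
      have hpc' : p ∈ interval G z c := by
        simp only [interval, Set.mem_ofPred_eq, dist_eq_one_iff_adj.2 hpc]
        omega
      by_cases hch' : ∃ d, d ≠ c ∧ G.Adj p d ∧ G.dist z d = G.dist z p + 1 ∧
          d ∈ interval G z u ∧ d ∈ S
      · obtain ⟨d, hdc, hpd, hzd, hdu, hdS⟩ := hch'
        have hdd := dist_succ_of_mem_interval hpu hdu hzd
        have hadj := adj_of_adj_closer hc hb hpd hpc hdd hcd hdc
        obtain ⟨e, heS, heu, hce, he⟩ := exists_exit_of_sibling hc hb hk4 hS hu n c d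
          (by omega) hcS hcu hadj.symm (by omega) (by omega)
        obtain ⟨f, hfS, hfu, hdf, hf⟩ := exists_exit_of_sibling hc hb hk4 hS hu n d c
          (by omega) hdS hdu hadj (by omega) (by omega)
        have hpe := interval_trans hc hpc' hce
        refine ⟨e, heS, heu, hpe, f, hfS, hfu, fun w hwS hwu hpw => ?_⟩
        by_cases hpw' : p = w
        · exact .inl (hpw' ▸ hpe)
        obtain ⟨x, hpx, hzx, hxw, -⟩ := exists_succ_mem_interval hc hpw hpw'
        have hxu := interval_trans hc hxw hwu
        by_cases hxc : x = c
        · exact .inl (he w hwS hwu (hxc ▸ hxw))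
        by_cases hxd : x = d
        · exact .inr (hf w hwS hwu (hxd ▸ hxw))
        exact (not_three_adj_closer hc hb hk4 hpx hpc hpd
          (dist_succ_of_mem_interval hpu hxu hzx) hcd hdd hxc hxd hdc.symm).elim
      · obtain ⟨e, heS, heu, hce, f, hfS, hfu, hef⟩ := ih c (by omega) hcS hcu
        have hpe := interval_trans hc hpc' hce
        refine ⟨e, heS, heu, hpe, f, hfS, hfu, fun w hwS hwu hpw => ?_⟩
        by_cases hpw' : p = w
        · exact .inl (hpw' ▸ hpe)
        obtain ⟨d, hpd, hzd, hdw, -⟩ := exists_succ_mem_interval hc hpw hpw'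
        have hdc : d = c := by
          by_contra hdc
          exact hch' ⟨d, hdc, hpd, hzd, interval_trans hc hdw hwu, hS.2.1 w hwS hdw⟩
        exact hef w hwS hwu (hdc ▸ hdw)
    · refine ⟨p, hpS, hpu, right_mem_interval G z p, p, hpS, hpu, fun w hwS hwu hpw => ?_⟩
      by_cases hpw' : p = w
      · exact .inl (hpw' ▸ right_mem_interval G z p)
      obtain ⟨d, hpd, hzd, hdw, -⟩ := exists_succ_mem_interval hc hpw hpw'
      exact absurd ⟨d, hpd, hzd, interval_trans hc hdw hwu, hS.2.1 w hwS hdw⟩ hch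

/-- A common vertex `w` of `I(z,u)` and `I(z,v)` at maximal distance from `z` is at distance at
most `d(u,v)` from both `u` and `v`. -/
theorem exists_mem_intervals_dist_le {G : SimpleGraph V} (hc : G.Connected) (hb : Bridged G)
    (z u v : V) : ∃ w, w ∈ interval G z u ∧ w ∈ interval G z v ∧
      G.dist u w ≤ G.dist u v ∧ G.dist v w ≤ G.dist u v := by
  classical
  let P : ℕ → Prop := fun k => ∃ w, w ∈ interval G z u ∧ w ∈ interval G z v ∧ G.dist z w = k
  have hP0 : P 0 := ⟨z, by simp [interval], by simp [interval], by simp⟩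
  obtain ⟨w, hwu, hwv, hk⟩ := Nat.findGreatest_spec (P := P) (Nat.zero_le (G.dist z u)) hP0
  have hmax : ∀ x, G.Adj w x → G.dist u x + 1 = G.dist u w → G.dist v x + 1 = G.dist v w →
      False := by
    intro x hwx hux hvx
    have h1 := dist_le_succ_of_adj hc z hwx
    have h2 := hc.dist_triangle (u := z) (v := x) (w := u)
    have h3 := hc.dist_triangle (u := z) (v := x) (w := v)
    simp only [interval, Set.mem_ofPred_eq] at hwu hwv
    rw [G.dist_comm (u := w)] at hwu hwv
    rw [G.dist_comm (u := x)] at h2 h3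
    have h4 : P (G.dist z x) := by
      refine ⟨x, ?_, ?_, rfl⟩ <;> simp only [interval, Set.mem_ofPred_eq] <;>
        rw [G.dist_comm (u := x)] <;> omega
    have h5 := Nat.le_findGreatest (n := G.dist z u) (by omega) h4
    omega
  refine ⟨w, hwu, hwv, ?_, ?_⟩ <;> by_contra hlt
  · obtain ⟨x, hwx, hux, hvx⟩ := exists_adj_closer_both hc hb u v _ w rfl (by omega)
    exact hmax x hwx hux hvx
  · obtain ⟨x, hwx, hvx, hux⟩ := exists_adj_closer_both hc hb v u _ w rfl
      (by rw [G.dist_comm (u := v)]; omega)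
    exact hmax x hwx hux hvx

/-- If `w` is a common ancestor of `e` and `v` and `e ∈ I(z,u)`, then the detour through `e`
costs at most `d(u,w) + d(w,v)`. -/
theorem StarshapedTree.dist_add_branchTree_dist_le {G : SimpleGraph V} (hc : G.Connected)
    {z : V} {S : Set V} (hS : StarshapedTree G z S) {u e v w : V} (he : e ∈ S) (hv : v ∈ S)
    (heu : e ∈ interval G z u) (hwe : w ∈ interval G z e) (hwv : w ∈ interval G z v) :
    G.dist u e + (branchTree G z S).dist e v ≤ G.dist u w + G.dist w v := by
  obtain ⟨p, hp⟩ := hS.exists_walk hc he _ w hwe rfl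
  obtain ⟨q, hq⟩ := hS.exists_walk hc hv _ w hwv rfl
  have h1 := dist_le (p.reverse.append q)
  rw [Walk.length_append, Walk.length_reverse, hp, hq] at h1
  have hwu := interval_trans hc hwe heu
  simp only [interval, Set.mem_ofPred_eq] at heu hwe hwu
  rw [G.dist_comm (u := u), G.dist_comm (u := u)]
  omega

/-- The exits lemma: there are two exits `u1, u2` on `I(u,z) ∩ T` such that going
through one of them approximates distances to `T` within a factor 2. -/
theorem stmt15 (G : SimpleGraph V) (hc : G.Connected) (hb : Bridged G) (hk4 : K4Free G)
    (z : V) (S : Set V) (hS : StarshapedTree G z S) (u : V) (hu : u ∉ S) :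
    ∃ u1 ∈ interval G u z ∩ S, ∃ u2 ∈ interval G u z ∩ S,
      ∀ v ∈ S,
        min (G.dist u u1 + (branchTree G z S).dist u1 v)
            (G.dist u u2 + (branchTree G z S).dist u2 v) ≤ 2 * G.dist u v := by
  obtain ⟨e, heS, heu, -, f, hfS, hfu, hef⟩ := exists_two_exits hc hb hk4 hS hu _ z rfl hS.1
    (by simp [interval])
  refine ⟨e, ⟨mem_interval_symm heu, heS⟩, f, ⟨mem_interval_symm hfu, hfS⟩, fun v hv => ?_⟩
  obtain ⟨w, hwu, hwv, h1, h2⟩ := exists_mem_intervals_dist_le hc hb z u v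
  rw [G.dist_comm (u := v)] at h2
  obtain h | h := hef w (hS.2.1 v hv hwv) hwu (by simp [interval])
  · have := hS.dist_add_branchTree_dist_le hc heS hv heu h hwv
    exact (min_le_left _ _).trans (by omega)
  · have := hS.dist_add_branchTree_dist_le hc hfS hv hfu h hwv
    exact (min_le_right _ _).trans (by omega)
end
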